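/- arXiv:1105.3430 — 6 statements merged into one kernel-verified Lean document; each statement's English description precedes it below -/
import Mathlib

section
/- Let Y = m + ε, where m ∈ ℝⁿ is fixed and ε is a random vector with E[ε] = 0 and covariance matrix σ²I. Let S be a symmetric n×n real matrix such that all eigenvalues of I - S lie in [0,1), and let m̂_k = (I - (I-S)^k)Y. Then E[‖m̂_k - m‖²] = ‖(I-S)^k m‖² + σ² trace((I-(I-S)^k)(I-(I-S)^k)ᵀ), and E[‖m̂_k - m‖²] → nσ² as k → ∞. -/
open Matrix MeasureTheory Filter

/-- Powers of a real symmetric matrix with spectrum inside `(-1, 1)` tend to zero. -/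
theorem Matrix.IsHermitian.tendsto_pow_atTop_nhds_zero {ι : Type*} [Fintype ι] [DecidableEq ι]
    {A : Matrix ι ι ℝ} (hA : A.IsHermitian) (hspec : ∀ x ∈ spectrum ℝ A, |x| < 1) :
    Tendsto (fun k : ℕ => A ^ k) atTop (nhds 0) := by
  set φ := Unitary.conjStarAlgAut ℝ (Matrix ι ι ℝ) hA.eigenvectorUnitary with hφ
  have hpow : ∀ k : ℕ, A ^ k = φ (diagonal fun i => hA.eigenvalues i ^ k) := fun k => by
    conv_lhs => rw [hA.spectral_theorem]
    rw [← map_pow, diagonal_pow]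
    rfl
  have hdiag : Tendsto (fun k : ℕ => diagonal fun i => hA.eigenvalues i ^ k) atTop
      (nhds (diagonal (0 : ι → ℝ))) :=
    (continuous_id.matrix_diagonal.tendsto 0).comp <| tendsto_pi_nhds.2 fun i =>
      tendsto_pow_atTop_nhds_zero_of_abs_lt_one (hspec _ (hA.eigenvalues_mem_spectrum_real i))
  have hcont : Continuous φ := by
    simp only [hφ, funext (Unitary.conjStarAlgAut_apply _)]
    fun_prop
  simp only [hpow]
  exact (hcont.tendsto' _ _ (by rw [diagonal_zero', map_zero])).comp hdiag

/-- Bias-variance decomposition of the second moment of `b + M ε` for centred `ε` with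
covariance `σ² I`. -/
theorem integral_sum_sq_add_mulVec {ι κ Ω : Type*} [Fintype ι] [Fintype κ] [DecidableEq κ]
    [MeasurableSpace Ω] {μ : Measure Ω} [IsProbabilityMeasure μ] {ε : Ω → κ → ℝ} {σ : ℝ}
    (hint : ∀ i, Integrable (fun ω => ε ω i) μ) (hmean : ∀ i, ∫ ω, ε ω i ∂μ = 0)
    (hint₂ : ∀ i j, Integrable (fun ω => ε ω i * ε ω j) μ)
    (hcov : ∀ i j, ∫ ω, ε ω i * ε ω j ∂μ = if i = j then σ ^ 2 else 0)
    (b : ι → ℝ) (M : Matrix ι κ ℝ) :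
    ∫ ω, ∑ i, (b i + (M *ᵥ ε ω) i) ^ 2 ∂μ = ∑ i, b i ^ 2 + σ ^ 2 * (M * Mᵀ).trace := by
  have hexpand : ∀ i ω, (b i + (M *ᵥ ε ω) i) ^ 2 =
      b i ^ 2 + ∑ j, 2 * b i * M i j * ε ω j
        + ∑ j, ∑ l, M i j * M i l * (ε ω j * ε ω l) := fun i ω => by
    have hlin : ∑ j, 2 * b i * M i j * ε ω j = 2 * b i * (M *ᵥ ε ω) i := by
      simp only [mulVec, dotProduct, Finset.mul_sum, mul_assoc]
    have hquad : ∑ j, ∑ l, M i j * M i l * (ε ω j * ε ω l) = (M *ᵥ ε ω) i ^ 2 := by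
      simp only [mulVec, dotProduct, sq, Finset.sum_mul_sum, mul_mul_mul_comm]
    rw [hlin, hquad]
    ring
  have hL : ∀ i, Integrable (fun ω => ∑ j, 2 * b i * M i j * ε ω j) μ := fun i =>
    integrable_finsetSum _ fun j _ => (hint j).const_mul _
  have hQ' : ∀ i j, Integrable (fun ω => ∑ l, M i j * M i l * (ε ω j * ε ω l)) μ := fun i j =>
    integrable_finsetSum _ fun l _ => (hint₂ j l).const_mul _
  have hQ : ∀ i, Integrable (fun ω => ∑ j, ∑ l, M i j * M i l * (ε ω j * ε ω l)) μ := fun i =>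
    integrable_finsetSum _ fun j _ => hQ' i j
  have hBL : ∀ i, Integrable (fun ω => b i ^ 2 + ∑ j, 2 * b i * M i j * ε ω j) μ := fun i =>
    (integrable_const _).add (hL i)
  have hBLQ : ∀ i, Integrable (fun ω => b i ^ 2 + ∑ j, 2 * b i * M i j * ε ω j
      + ∑ j, ∑ l, M i j * M i l * (ε ω j * ε ω l)) μ := fun i =>
    (hBL i).add (hQ i)
  simp only [hexpand]
  rw [integral_finsetSum _ fun i _ => hBLQ i, trace, Finset.mul_sum,
    ← Finset.sum_add_distrib]
  refine Finset.sum_congr rfl fun i _ => ?_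
  rw [integral_add (hBL i) (hQ i), integral_add (integrable_const _) (hL i),
    integral_finsetSum _ fun j _ => (hint j).const_mul _, integral_finsetSum _ fun j _ => hQ' i j]
  simp only [integral_finsetSum _ fun l _ => (hint₂ _ l).const_mul _, integral_const_mul, hmean,
    hcov]
  simp [mul_apply, Finset.mul_sum, mul_comm]

/-- Mean squared error of the `k`-th iterated bias-corrected smoother: in the model
`Y = m + ε` with `E[ε]=0`, `Cov(ε)=σ²I`, for a symmetric `S` with eigenvalues of
`I - S` in `[0,1)`, `E‖m̂_k - m‖² = ‖(I-S)^k m‖² + σ² tr((I-(I-S)^k)(I-(I-S)^k)ᵀ)`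
and `E‖m̂_k - m‖² → nσ²` as `k → ∞`. -/
theorem stmt_5 {n : ℕ} {Ω : Type*} [MeasurableSpace Ω] (μ : Measure Ω)
    [IsProbabilityMeasure μ]
    (m : Fin n → ℝ) (ε : Ω → Fin n → ℝ) (σ : ℝ)
    (hεint : ∀ i, Integrable (fun ω => ε ω i) μ)
    (hεmean : ∀ i, ∫ ω, ε ω i ∂μ = 0)
    (hεint2 : ∀ i j, Integrable (fun ω => ε ω i * ε ω j) μ)
    (hεcov : ∀ i j, ∫ ω, ε ω i * ε ω j ∂μ = if i = j then σ ^ 2 else 0)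
    (S : Matrix (Fin n) (Fin n) ℝ) (hS : S.IsSymm)
    (hspec : spectrum ℝ ((1 : Matrix (Fin n) (Fin n) ℝ) - S) ⊆ Set.Ico (0 : ℝ) 1)
    (mhat : ℕ → Ω → Fin n → ℝ)
    (hmhat : ∀ k ω, mhat k ω = (1 - (1 - S) ^ k) *ᵥ (m + ε ω)) :
    (∀ k : ℕ, ∫ ω, (∑ i, (mhat k ω i - m i) ^ 2) ∂μ
        = (∑ i, ((1 - S) ^ k *ᵥ m) i ^ 2)
          + σ ^ 2 * ((1 - (1 - S) ^ k) * (1 - (1 - S) ^ k)ᵀ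
              : Matrix (Fin n) (Fin n) ℝ).trace) ∧
    Tendsto (fun k : ℕ => ∫ ω, (∑ i, (mhat k ω i - m i) ^ 2) ∂μ) atTop
      (nhds ((n : ℝ) * σ ^ 2)) := by
  have hmse : ∀ k : ℕ, ∫ ω, (∑ i, (mhat k ω i - m i) ^ 2) ∂μ
      = (∑ i, ((1 - S) ^ k *ᵥ m) i ^ 2)
        + σ ^ 2 * ((1 - (1 - S) ^ k) * (1 - (1 - S) ^ k)ᵀ
            : Matrix (Fin n) (Fin n) ℝ).trace := fun k => by
    have herr : ∀ ω i, mhat k ω i - m i =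
        (-((1 - S) ^ k *ᵥ m)) i + ((1 - (1 - S) ^ k) *ᵥ ε ω) i := fun ω i => by
      rw [hmhat, mulVec_add, sub_mulVec _ _ m, one_mulVec]
      simp only [Pi.add_apply, Pi.sub_apply, Pi.neg_apply]
      ring
    simp only [herr, integral_sum_sq_add_mulVec hεint hεmean hεint2 hεcov, Pi.neg_apply, neg_sq]
  refine ⟨hmse, ?_⟩
  have hA : (1 - S).IsHermitian := by
    rw [IsHermitian, conjTranspose_eq_transpose_of_trivial, transpose_sub, transpose_one, hS.eq]
  have hpow := hA.tendsto_pow_atTop_nhds_zero fun x hx =>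
    abs_lt.2 ⟨by linarith [(hspec hx).1], (hspec hx).2⟩
  have hcont : Continuous fun B : Matrix (Fin n) (Fin n) ℝ =>
      (∑ i, (B *ᵥ m) i ^ 2) + σ ^ 2 * ((1 - B) * (1 - B)ᵀ).trace := by
    fun_prop
  simp only [hmse]
  refine (hcont.tendsto' 0 _ ?_).comp hpow
  simp [mul_comm]
end

section
/- Let 𝕂 be a symmetric positive semidefinite n×n real matrix with nonnegative entries and strictly positive row sums r_i = Σ_j 𝕂_{ij}. Let D be the diagonal matrix with D_{ii} = 1/r_i. Then every eigenvalue of the row-stochastic matrix S = D𝕂 is real and lies in the interval [0, 1]. -/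
open Matrix

open scoped ComplexOrder

/-- Complexification preserves positive semidefiniteness of a real matrix. -/
theorem Matrix.PosSemidef.map_algebraMap_complex {ι : Type*} [Fintype ι] {K : Matrix ι ι ℝ}
    (hK : K.PosSemidef) : (K.map (algebraMap ℝ ℂ)).PosSemidef := by
  obtain ⟨m, w, rfl⟩ := Matrix.posSemidef_iff_eq_sum_vecMulVec.mp hK
  have h : (∑ i, vecMulVec (w i) (star (w i))).map (algebraMap ℝ ℂ) =
      ∑ i, vecMulVec (algebraMap ℝ ℂ ∘ w i) (star (algebraMap ℝ ℂ ∘ w i)) := by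
    ext j k
    simp [Matrix.sum_apply, vecMulVec_apply]
  rw [h]
  exact Matrix.posSemidef_sum _ fun i _ => Matrix.posSemidef_vecMulVec_self_star _

/-- Elements of the spectrum of a matrix over a field have eigenvectors. -/
theorem Matrix.exists_mulVec_eq_smul_of_mem_spectrum {𝕜 ι : Type*} [Field 𝕜] [Fintype ι]
    [DecidableEq ι] {A : Matrix ι ι 𝕜} {z : 𝕜} (hz : z ∈ spectrum 𝕜 A) :
    ∃ v, v ≠ 0 ∧ A *ᵥ v = z • v := by
  rw [← Matrix.spectrum_toLin', ← Module.End.hasEigenvalue_iff_mem_spectrum] at hz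
  obtain ⟨v, hv⟩ := hz.exists_hasEigenvector
  exact ⟨v, hv.2, by simpa using hv.apply_eq_smul⟩

/-- If `𝕂` is symmetric positive semidefinite with nonnegative entries and strictly
positive row sums `r_i`, and `D = diag(1/r_i)`, then every eigenvalue of the
row-stochastic matrix `S = D𝕂` is real and lies in `[0, 1]`. -/
theorem stmt_7 {n : ℕ} (K : Matrix (Fin n) (Fin n) ℝ) (hK : K.PosSemidef)
    (hKnn : ∀ i j, 0 ≤ K i j)
    (r : Fin n → ℝ) (hr : ∀ i, r i = ∑ j, K i j) (hrpos : ∀ i, 0 < r i)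
    (S : Matrix (Fin n) (Fin n) ℝ)
    (hS : S = Matrix.diagonal (fun i => (r i)⁻¹) * K) :
    ∀ z ∈ spectrum ℂ (S.map (algebraMap ℝ ℂ)),
      z.im = 0 ∧ 0 ≤ z.re ∧ z.re ≤ 1 := by
  intro z hz
  obtain ⟨v, hv0, hv⟩ := Matrix.exists_mulVec_eq_smul_of_mem_spectrum hz
  have hKv (i) : (K.map (algebraMap ℝ ℂ) *ᵥ v) i = z * (r i * v i) := by
    have hri : (r i : ℂ) ≠ 0 := by exact_mod_cast (hrpos i).ne'
    have hS' : S.map (algebraMap ℝ ℂ) =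
        diagonal (fun i => (r i : ℂ)⁻¹) * K.map (algebraMap ℝ ℂ) := by
      ext i j
      simp [hS, diagonal_mul]
    have h := congrFun hv i
    rw [hS', ← mulVec_mulVec, mulVec_diagonal, Pi.smul_apply, smul_eq_mul,
      inv_mul_eq_iff_eq_mul₀ hri] at h
    rw [h]
    ring
  obtain ⟨k, hk⟩ := Function.ne_iff.mp hv0
  have hform : star v ⬝ᵥ (K.map (algebraMap ℝ ℂ) *ᵥ v) =
      z * ((∑ i, r i * ‖v i‖ ^ 2 : ℝ) : ℂ) := by
    simp only [dotProduct, hKv, Pi.star_apply, Complex.ofReal_sum, Finset.mul_sum]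
    refine Finset.sum_congr rfl fun i _ => ?_
    push_cast
    rw [← Complex.conj_mul', ← Complex.star_def]
    ring
  have hR : 0 < ∑ i, r i * ‖v i‖ ^ 2 :=
    Finset.sum_pos' (fun i _ => mul_nonneg (hrpos i).le (sq_nonneg _))
      ⟨k, Finset.mem_univ k, mul_pos (hrpos k) (pow_pos (norm_pos_iff.mpr hk) 2)⟩
  have hpos := hK.map_algebraMap_complex.dotProduct_mulVec_nonneg v
  rw [hform, Complex.nonneg_iff, Complex.re_mul_ofReal, Complex.im_mul_ofReal] at hpos
  refine ⟨(mul_eq_zero.mp hpos.2.symm).resolve_right hR.ne',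
    nonneg_of_mul_nonneg_left hpos.1 hR, (Complex.re_le_norm z).trans ?_⟩
  obtain ⟨m, -, hm⟩ := Finset.exists_max_image Finset.univ (fun i => ‖v i‖) ⟨k, Finset.mem_univ k⟩
  have hvm : 0 < ‖v m‖ := (norm_pos_iff.mpr hk).trans_le (hm k (Finset.mem_univ k))
  have hle : ‖z‖ * (r m * ‖v m‖) ≤ r m * ‖v m‖ := calc
    ‖z‖ * (r m * ‖v m‖) = ‖(K.map (algebraMap ℝ ℂ) *ᵥ v) m‖ := by
      rw [hKv, norm_mul, norm_mul, Complex.norm_of_nonneg (hrpos m).le]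
    _ ≤ ∑ j, K m j * ‖v j‖ := by
      rw [mulVec, dotProduct]
      refine (norm_sum_le _ _).trans (Finset.sum_le_sum fun j _ => ?_)
      rw [norm_mul, map_apply, Complex.coe_algebraMap, Complex.norm_of_nonneg (hKnn m j)]
    _ ≤ ∑ j, K m j * ‖v m‖ :=
      Finset.sum_le_sum fun j hj => mul_le_mul_of_nonneg_left (hm j hj) (hKnn m j)
    _ = r m * ‖v m‖ := by rw [hr, Finset.sum_mul]
  exact le_of_mul_le_mul_right (by rwa [one_mul]) (mul_pos (hrpos m) hvm)
end

section
/- Let K : ℝ → ℝ be an even, integrable function, and suppose there is a bounded, symmetric (A = -A), Lebesgue-measurable set A ⊂ ℝ of positive Lebesgue measure such that the Fourier transform K̂(t) = ∫ e^{-2πitx} K(x) dx satisfies K̂(t) < 0 for every t ∈ A. Then there exists a real-valued function φ, integrable and square-integrable on ℝ, such that ∫∫ φ(x) φ(y) K(x - y) dx dy < 0. -/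
open MeasureTheory
open scoped FourierTransform ComplexOrder

lemma integrable_prod_mul_convolution_kernel {φ K : ℝ → ℝ} (hφ : Integrable φ)
    (hcont : Continuous φ) {C : ℝ} (hC : ∀ x, |φ x| ≤ C) (hK : Integrable K) :
    Integrable (fun p : ℝ × ℝ => φ p.1 * φ (p.1 - p.2) * K p.2) (volume.prod volume) := by
  have h := (hφ.mul_prod hK).bdd_mul (c := C) (f := fun p : ℝ × ℝ => φ (p.1 - p.2))
    (by fun_prop : Continuous fun p : ℝ × ℝ => φ (p.1 - p.2)).aestronglyMeasurable
    (Filter.Eventually.of_forall fun p => hC _)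
  refine h.congr (Filter.Eventually.of_forall fun p => ?_)
  simp only
  ring

lemma integral_integral_mul_convolution_kernel {φ K : ℝ → ℝ} (hφ : Integrable φ)
    (hcont : Continuous φ) {C : ℝ} (hC : ∀ x, |φ x| ≤ C) (hK : Integrable K) :
    ∫ x : ℝ, ∫ y : ℝ, φ x * φ y * K (x - y)
      = ∫ p : ℝ × ℝ, φ p.1 * φ (p.1 - p.2) * K p.2 ∂(volume.prod volume) := by
  rw [integral_prod _ (integrable_prod_mul_convolution_kernel hφ hcont hC hK)]
  congr 1 with x
  rw [← integral_sub_left_eq_self (fun y => φ x * φ y * K (x - y)) volume x]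
  simp

lemma re_fourier_ofReal {K : ℝ → ℝ} (hK : Integrable K) (t : ℝ) :
    (𝓕 (fun x : ℝ => (K x : ℂ)) t).re = ∫ u, Real.cos (2 * Real.pi * t * u) * K u := by
  rw [Real.fourier_eq']
  have hint : Integrable (fun v : ℝ =>
      Complex.exp (↑(-2 * Real.pi * inner ℝ v t) * Complex.I) • (K v : ℂ)) := by
    refine hK.ofReal.bdd_mul (c := 1) (Continuous.aestronglyMeasurable (by fun_prop))
      (Filter.Eventually.of_forall fun v => ?_)
    rw [Complex.norm_exp_ofReal_mul_I]
  have h := integral_re hint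
  simp only [RCLike.re_to_complex] at h
  rw [← h]
  congr 1 with u
  rw [smul_eq_mul, Complex.re_mul_ofReal, Complex.exp_ofReal_mul_I_re, ← Real.cos_neg]
  congr 2
  simp
  ring

lemma integral_gaussian_mul_gaussian_sub (b u : ℝ) :
    ∫ x : ℝ, Real.exp (-b * x ^ 2) * Real.exp (-b * (x - u) ^ 2)
      = Real.sqrt (Real.pi / (2 * b)) * Real.exp (-b * u ^ 2 / 2) := by
  have h (x : ℝ) : Real.exp (-b * x ^ 2) * Real.exp (-b * (x - u) ^ 2)
      = Real.exp (-(2 * b) * (x - u / 2) ^ 2) * Real.exp (-b * u ^ 2 / 2) := by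
    rw [← Real.exp_add, ← Real.exp_add]
    ring_nf
  simp_rw [h]
  rw [integral_mul_const, integral_sub_right_eq_self (fun x => Real.exp (-(2 * b) * x ^ 2)),
    integral_gaussian]

lemma exists_gaussian_damped_integral_neg {f : ℝ → ℝ} (hf : Integrable f) (hneg : ∫ u, f u < 0) :
    ∃ b : ℝ, 0 < b ∧ ∫ u, Real.exp (-b * u ^ 2 / 2) * f u < 0 := by
  have hlim : Filter.Tendsto (fun b : ℝ => ∫ u, Real.exp (-b * u ^ 2 / 2) * f u)
      (nhdsWithin 0 (Set.Ioi 0)) (nhds (∫ u, f u)) := by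
    refine tendsto_integral_filter_of_dominated_convergence (fun u => |f u|)
      (Filter.Eventually.of_forall fun b =>
        (by fun_prop : Continuous fun u : ℝ => Real.exp (-b * u ^ 2 / 2)).aestronglyMeasurable.mul
          hf.aestronglyMeasurable) ?_ hf.abs (Filter.Eventually.of_forall fun u => ?_)
    · filter_upwards [self_mem_nhdsWithin] with b hb
      refine Filter.Eventually.of_forall fun u => ?_
      have hb' : (0 : ℝ) < b := hb
      rw [norm_mul, Real.norm_eq_abs, Real.norm_eq_abs, Real.abs_exp]
      refine mul_le_of_le_one_left (abs_nonneg _) (Real.exp_le_one_iff.2 ?_)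
      nlinarith [mul_nonneg hb'.le (sq_nonneg u)]
    · have hc : Continuous fun b : ℝ => Real.exp (-b * u ^ 2 / 2) * f u := by fun_prop
      simpa using (hc.tendsto 0).mono_left nhdsWithin_le_nhds
  obtain ⟨b, hb, hb0⟩ :=
    ((hlim.eventually_lt_const hneg).and self_mem_nhdsWithin).exists
  exact ⟨b, hb0, hb⟩

/-- If an even integrable kernel `K` has a Fourier transform that is negative on a
bounded symmetric set `A` of positive Lebesgue measure, then there is a real-valued
integrable and square-integrable `φ` with `∫∫ φ(x)φ(y)K(x-y) dx dy < 0`. -/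
theorem stmt_9 (K : ℝ → ℝ) (hKeven : ∀ x, K (-x) = K x)
    (hKint : Integrable K)
    (A : Set ℝ) (hAbdd : Bornology.IsBounded A) (hAsymm : ∀ x ∈ A, -x ∈ A)
    (hAmeas : MeasurableSet A) (hApos : 0 < volume A)
    (hKhat : ∀ t ∈ A, 𝓕 (fun x : ℝ => (K x : ℂ)) t < 0) :
    ∃ φ : ℝ → ℝ, Integrable φ ∧ Integrable (fun x => φ x ^ 2) ∧
      ∫ x : ℝ, ∫ y : ℝ, φ x * φ y * K (x - y) < 0 := by
  obtain ⟨t, ht⟩ := nonempty_of_measure_ne_zero hApos.ne'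
  have hneg := (Complex.lt_def.1 (hKhat t ht)).1
  rw [re_fourier_ofReal hKint, Complex.zero_re] at hneg
  set a := 2 * Real.pi * t
  have hfint : Integrable fun u => Real.cos (a * u) * K u :=
    hKint.bdd_mul (c := 1) (Continuous.aestronglyMeasurable (by fun_prop))
      (Filter.Eventually.of_forall fun u => Real.abs_cos_le_one _)
  obtain ⟨b, hb, hbneg⟩ := exists_gaussian_damped_integral_neg hfint hneg
  -- Modulating the Gaussian by a cosine and by a sine gives two quadratic forms with negative sum.
  have hg : Integrable fun x : ℝ => Real.exp (-b * x ^ 2) := integrable_exp_neg_mul_sq hb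
  have key (m : ℝ → ℝ) (hm : Continuous m) (hm1 : ∀ x, |m x| ≤ 1) :
      Continuous (fun x => m x * Real.exp (-b * x ^ 2)) ∧
      Integrable (fun x => m x * Real.exp (-b * x ^ 2)) ∧
      (∀ x, |m x * Real.exp (-b * x ^ 2)| ≤ 1) := by
    refine ⟨by fun_prop, hg.bdd_mul (c := 1) hm.aestronglyMeasurable
      (Filter.Eventually.of_forall hm1), fun x => ?_⟩
    rw [abs_mul, Real.abs_exp]
    refine mul_le_one₀ (hm1 x) (Real.exp_pos _).le (Real.exp_le_one_iff.2 ?_)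
    nlinarith [mul_nonneg hb.le (sq_nonneg x)]
  have sq_int {φ : ℝ → ℝ} (hc : Continuous φ) (hi : Integrable φ) (h1 : ∀ x, |φ x| ≤ 1) :
      Integrable fun x => φ x ^ 2 := by
    simp_rw [sq]
    exact hi.bdd_mul (c := 1) hc.aestronglyMeasurable (Filter.Eventually.of_forall h1)
  obtain ⟨cc, ci, cb⟩ := key (fun x => Real.cos (a * x)) (by fun_prop)
    fun x => Real.abs_cos_le_one _
  obtain ⟨sc, si, sb⟩ := key (fun x => Real.sin (a * x)) (by fun_prop)
    fun x => Real.abs_sin_le_one _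
  have ic := integrable_prod_mul_convolution_kernel ci cc cb hKint
  have is := integrable_prod_mul_convolution_kernel si sc sb hKint
  have hsum := integral_add' ic is
  rw [← integral_integral_mul_convolution_kernel ci cc cb hKint,
    ← integral_integral_mul_convolution_kernel si sc sb hKint,
    integral_prod_symm _ (ic.add is)] at hsum
  have hinner (u : ℝ) :
      ∫ x : ℝ, (Real.cos (a * x) * Real.exp (-b * x ^ 2) *
          (Real.cos (a * (x - u)) * Real.exp (-b * (x - u) ^ 2)) * K u +
        Real.sin (a * x) * Real.exp (-b * x ^ 2) *
          (Real.sin (a * (x - u)) * Real.exp (-b * (x - u) ^ 2)) * K u)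
      = Real.sqrt (Real.pi / (2 * b)) *
          (Real.exp (-b * u ^ 2 / 2) * (Real.cos (a * u) * K u)) := by
    rw [← mul_assoc, ← integral_gaussian_mul_gaussian_sub, ← integral_mul_const]
    congr 1 with x
    have hcos : Real.cos (a * u) = Real.cos (a * x) * Real.cos (a * (x - u)) +
        Real.sin (a * x) * Real.sin (a * (x - u)) := by
      rw [← Real.cos_sub]
      ring_nf
    rw [hcos]
    ring
  simp only [Pi.add_apply, hinner] at hsum
  rw [integral_const_mul] at hsum
  have hlt := mul_neg_of_pos_of_neg
    (Real.sqrt_pos.2 (by positivity : 0 < Real.pi / (2 * b))) hbneg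
  rw [hsum] at hlt
  rcases lt_or_ge (∫ x : ℝ, ∫ y : ℝ, Real.cos (a * x) * Real.exp (-b * x ^ 2) *
    (Real.cos (a * y) * Real.exp (-b * y ^ 2)) * K (x - y)) 0 with h | h
  · exact ⟨_, ci, sq_int cc ci cb, h⟩
  · exact ⟨_, si, sq_int sc si sb, by linarith⟩
end

section
/- Let d ≥ 1, let h_1, ..., h_d > 0, and equip ℝ^d with the weighted Euclidean distance d_h(x,y) = √(Σ_{l=1}^d ((x_l - y_l)/h_l)²). Let K be the uniform kernel, K(t) = 1 if |t| ≤ 1 and K(t) = 0 otherwise. Let X_1, ..., X_n ∈ ℝ^d and suppose there exist indices i, j, k such that d_h(X_i, X_j) < 1, d_h(X_i, X_k) < 1, and d_h(X_j, X_k) > 1. Then the n×n Gram matrix 𝕂 with entries 𝕂_{ab} = K(d_h(X_a, X_b)) is not positive semidefinite; in particular it has a negative eigenvalue. -/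
open Matrix

/-- A real matrix with a `3 × 3` principal submatrix of the form
`!![1, 1, 1; 1, 1, 0; 1, 0, 1]`, whose determinant is `-1`, is not positive semidefinite. -/
theorem not_posSemidef_of_submatrix_eq {ι : Type*} {A : Matrix ι ι ℝ} (e : Fin 3 → ι)
    (hA : A.submatrix e e = !![1, 1, 1; 1, 1, 0; 1, 0, 1]) : ¬ A.PosSemidef := by
  intro hpsd
  have hdet := (hpsd.submatrix e).det_nonneg
  rw [hA, det_fin_three] at hdet
  simp at hdet
  norm_num at hdet

/-- A Hermitian real matrix that is not positive semidefinite has a negative eigenvalue. -/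
theorem exists_mem_spectrum_neg_of_not_posSemidef {ι : Type*} [Fintype ι] [DecidableEq ι]
    {A : Matrix ι ι ℝ} (hA : A.IsHermitian) (hpsd : ¬ A.PosSemidef) :
    ∃ μ ∈ spectrum ℝ A, μ < 0 := by
  contrapose! hpsd
  exact posSemidef_iff_isHermitian_and_spectrum_nonneg.mpr ⟨hA, hpsd⟩

/-- Uniform-kernel part of Proposition 5: if three design points `X_i, X_j, X_k`
satisfy `d_h(X_i,X_j) < 1`, `d_h(X_i,X_k) < 1` and `d_h(X_j,X_k) > 1` for the
weighted Euclidean distance `d_h`, then the Gram matrix of the uniform kernel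
`K(t) = 𝟙(|t| ≤ 1)` is not positive semidefinite and has a negative eigenvalue. -/
theorem stmt_11 {d n : ℕ} (hd : 1 ≤ d) (h : Fin d → ℝ) (hh : ∀ l, 0 < h l)
    (dh : (Fin d → ℝ) → (Fin d → ℝ) → ℝ)
    (hdh : ∀ x y, dh x y = Real.sqrt (∑ l, ((x l - y l) / h l) ^ 2))
    (K : ℝ → ℝ) (hK : ∀ t, K t = if |t| ≤ 1 then 1 else 0)
    (X : Fin n → (Fin d → ℝ)) (i j k : Fin n)
    (hij : dh (X i) (X j) < 1) (hik : dh (X i) (X k) < 1)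
    (hjk : 1 < dh (X j) (X k)) :
    ¬ (Matrix.of fun a b : Fin n => K (dh (X a) (X b))).PosSemidef ∧
      ∃ μ ∈ spectrum ℝ (Matrix.of fun a b : Fin n => K (dh (X a) (X b))), μ < 0 := by
  have dh_comm : ∀ x y, dh x y = dh y x := by
    intro x y
    rw [hdh, hdh]
    congr 1
    refine Finset.sum_congr rfl fun l _ => ?_
    ring
  have dh_nonneg : ∀ x y, 0 ≤ dh x y := fun x y => by
    rw [hdh]
    exact Real.sqrt_nonneg _
  have K_eq_one : ∀ x y, dh x y ≤ 1 → K (dh x y) = 1 := fun x y hxy => by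
    rw [hK, abs_of_nonneg (dh_nonneg x y), if_pos hxy]
  have K_self : ∀ x, K (dh x x) = 1 := fun x => K_eq_one x x (by simp [hdh])
  have K_jk : K (dh (X j) (X k)) = 0 := by
    rw [hK, abs_of_nonneg (dh_nonneg _ _), if_neg hjk.not_ge]
  have K_ij := K_eq_one _ _ hij.le
  have K_ik := K_eq_one _ _ hik.le
  have hherm : (Matrix.of fun a b : Fin n => K (dh (X a) (X b))).IsHermitian := by
    ext a b
    simp [dh_comm (X b) (X a)]
  have hpsd : ¬ (Matrix.of fun a b : Fin n => K (dh (X a) (X b))).PosSemidef := by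
    refine not_posSemidef_of_submatrix_eq ![i, j, k] ?_
    ext a b
    fin_cases a <;> fin_cases b <;>
      simp [K_self, K_ij, K_ik, K_jk, dh_comm (X j) (X i), dh_comm (X k) (X i),
        dh_comm (X k) (X j)]
  exact ⟨hpsd, exists_mem_spectrum_neg_of_not_posSemidef hherm hpsd⟩
end

section
/- Let λ_0 > 0, α > 1, and let M_0 < J ≤ n be integers. Let λ_1, ..., λ_n be reals with λ_j = 1 for 1 ≤ j ≤ M_0 and 0 ≤ λ_j ≤ 1/(1 + λ_0 j^α) for M_0 < j ≤ n. Then for every integer k ≥ 1, Σ_{j=1}^n (1 - (1 - λ_j)^k)² ≤ J + (k² / (λ_0² (2α - 1))) · J^{1 - 2α}. -/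
open Finset

theorem sum_Ioc_rpow_le {s : ℝ} (hs : 1 < s) {J n : ℕ} (hJ : 0 < J) (hJn : J ≤ n) :
    ∑ j ∈ Finset.Ioc J n, (j : ℝ) ^ (-s) ≤ (J : ℝ) ^ (1 - s) / (s - 1) := by
  have hJ' : (0 : ℝ) < J := by exact_mod_cast hJ
  have hJn' : (J : ℝ) ≤ n := by exact_mod_cast hJn
  have hanti : AntitoneOn (fun x : ℝ => x ^ (-s)) (Set.Icc (J : ℝ) n) := fun x hx y _ hxy =>
    Real.rpow_le_rpow_of_nonpos (hJ'.trans_le hx.1) hxy (by linarith)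
  have hsum := hanti.sum_le_integral_Ico hJn
  rw [integral_rpow (Or.inr ⟨by linarith, Set.notMem_uIcc_of_lt hJ' (hJ'.trans_le hJn')⟩),
    Finset.sum_Ico_add' (fun j : ℕ => (j : ℝ) ^ (-s)) J n 1] at hsum
  have hset : Finset.Ico (J + 1) (n + 1) = Finset.Ioc J n := by
    ext j
    simp only [Finset.mem_Ico, Finset.mem_Ioc]
    omega
  rw [hset] at hsum
  refine hsum.trans ?_
  have hn : (0 : ℝ) ≤ (n : ℝ) ^ (1 - s) := by positivity
  rw [show -s + 1 = 1 - s by ring, ← neg_sub s 1, div_neg, ← neg_div, neg_sub s 1]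
  exact div_le_div_of_nonneg_right (by linarith) (by linarith)

theorem one_sub_one_sub_pow_le {u : ℝ} (hu : u ≤ 1) (k : ℕ) :
    1 - (1 - u) ^ k ≤ k * u := by
  have h := one_add_mul_le_pow (show (-2 : ℝ) ≤ -u by linarith) k
  rw [← sub_eq_add_neg] at h
  linarith

theorem one_sub_one_sub_pow_mem_Icc {u : ℝ} (hu₀ : 0 ≤ u) (hu₁ : u ≤ 1) (k : ℕ) :
    1 - (1 - u) ^ k ∈ Set.Icc (0 : ℝ) 1 :=
  ⟨sub_nonneg.2 (pow_le_one₀ (by linarith) (by linarith)),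
    sub_le_self _ (pow_nonneg (by linarith) k)⟩

/-- Variance bound in the proof of Theorem 2: if `λ_j = 1` for `j ≤ M_0` and
`0 ≤ λ_j ≤ 1/(1 + λ_0 j^α)` for `M_0 < j ≤ n`, then for every `k ≥ 1`,
`Σ_{j=1}^n (1 - (1-λ_j)^k)² ≤ J + (k²/(λ_0²(2α-1))) J^{1-2α}`. -/
theorem stmt_12 (lam0 : ℝ) (hlam0 : 0 < lam0) (α : ℝ) (hα : 1 < α)
    (M0 J n : ℕ) (hMJ : M0 < J) (hJn : J ≤ n)
    (lam : ℕ → ℝ)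
    (hlam1 : ∀ j : ℕ, 1 ≤ j → j ≤ M0 → lam j = 1)
    (hlam2 : ∀ j : ℕ, M0 < j → j ≤ n →
      0 ≤ lam j ∧ lam j ≤ 1 / (1 + lam0 * (j : ℝ) ^ α)) :
    ∀ k : ℕ, 1 ≤ k →
      ∑ j ∈ Finset.Icc 1 n, (1 - (1 - lam j) ^ k) ^ 2 ≤
        (J : ℝ) + ((k : ℝ) ^ 2 / (lam0 ^ 2 * (2 * α - 1))) * (J : ℝ) ^ (1 - 2 * α) := by
  intro k _
  have hden (j : ℕ) : 1 ≤ 1 + lam0 * (j : ℝ) ^ α :=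
    le_add_of_nonneg_right (by positivity)
  have hmem (j : ℕ) (hj : 1 ≤ j) (hjn : j ≤ n) : 0 ≤ lam j ∧ lam j ≤ 1 := by
    rcases le_or_gt j M0 with h | h
    · simp [hlam1 j hj h]
    · exact ⟨(hlam2 j h hjn).1,
        (hlam2 j h hjn).2.trans (div_le_one_of_le₀ (hden j) (by linarith [hden j]))⟩
  have hJ : 0 < J := by omega
  have hhead : ∑ j ∈ Finset.Ioc 0 J, (1 - (1 - lam j) ^ k) ^ 2 ≤ (J : ℝ) := by
    have h : ∀ j ∈ Finset.Ioc 0 J, (1 - (1 - lam j) ^ k) ^ 2 ≤ (1 : ℝ) := fun j hj => by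
      obtain ⟨hj₀, hj₁⟩ := Finset.mem_Ioc.1 hj
      obtain ⟨h₀, h₁⟩ := hmem j hj₀ (hj₁.trans hJn)
      obtain ⟨hl, hr⟩ := one_sub_one_sub_pow_mem_Icc h₀ h₁ k
      exact pow_le_one₀ hl hr
    simpa using Finset.sum_le_sum h
  have htail : ∑ j ∈ Finset.Ioc J n, (1 - (1 - lam j) ^ k) ^ 2 ≤
      (k : ℝ) ^ 2 / (lam0 ^ 2 * (2 * α - 1)) * (J : ℝ) ^ (1 - 2 * α) := by
    have h : ∀ j ∈ Finset.Ioc J n, (1 - (1 - lam j) ^ k) ^ 2 ≤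
        (k : ℝ) ^ 2 / lam0 ^ 2 * (j : ℝ) ^ (-(2 * α)) := fun j hj => by
      obtain ⟨hj₀, hj₁⟩ := Finset.mem_Ioc.1 hj
      obtain ⟨h₀, h₁⟩ := hmem j (by omega) hj₁
      have hjpos : (0 : ℝ) < j := by exact_mod_cast (by omega : 0 < j)
      have hpos : 0 < lam0 * (j : ℝ) ^ α := by positivity
      have hle : lam j ≤ 1 / (lam0 * (j : ℝ) ^ α) :=
        (hlam2 j (by omega) hj₁).2.trans (one_div_le_one_div_of_le hpos (by linarith))
      calc (1 - (1 - lam j) ^ k) ^ 2 ≤ (k * (1 / (lam0 * (j : ℝ) ^ α))) ^ 2 :=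
            pow_le_pow_left₀ (one_sub_one_sub_pow_mem_Icc h₀ h₁ k).1
              ((one_sub_one_sub_pow_le h₁ k).trans (by gcongr)) 2
        _ = (k : ℝ) ^ 2 / lam0 ^ 2 * (j : ℝ) ^ (-(2 * α)) := by
            rw [Real.rpow_neg hjpos.le, two_mul, Real.rpow_add hjpos]
            field_simp
    calc _ ≤ ∑ j ∈ Finset.Ioc J n, (k : ℝ) ^ 2 / lam0 ^ 2 * (j : ℝ) ^ (-(2 * α)) :=
          Finset.sum_le_sum h
      _ ≤ (k : ℝ) ^ 2 / lam0 ^ 2 * ((J : ℝ) ^ (1 - 2 * α) / (2 * α - 1)) := by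
          rw [← Finset.mul_sum]
          gcongr
          exact sum_Ioc_rpow_le (by linarith) hJ hJn
      _ = _ := by rw [div_mul_div_comm, div_mul_eq_mul_div]
  have hsplit : Finset.Icc 1 n = Finset.Ioc 0 n := rfl
  rw [hsplit, ← Finset.sum_Ioc_consecutive _ (Nat.zero_le J) hJn]
  exact add_le_add hhead htail
end

section
/- Let λ_1, ..., λ_n ∈ (0, 1], and for each integer k ≥ 1 set β_j(k) = 1 - (1 - λ_j)^k. Then the map k ↦ (Σ_{j=1}^n β_j(k))² / (Σ_{j=1}^n β_j(k)²) is nondecreasing in k. -/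
open Finset

/-- A Chebyshev-type sum inequality: if `c` and the ratio `b / a` vary in opposite directions, then
`(∑ a) (∑ c b) ≤ (∑ b) (∑ c a)`. -/
theorem sum_mul_sum_mul_le_of_opposite {ι : Type*} (s : Finset ι) (a b c : ι → ℝ)
    (h : ∀ i j, (c j - c i) * (a i * b j - b i * a j) ≤ 0) :
    (∑ i ∈ s, a i) * (∑ i ∈ s, c i * b i) ≤ (∑ i ∈ s, b i) * (∑ i ∈ s, c i * a i) := by
  have hsum : ∑ i ∈ s, ∑ j ∈ s, (c j - c i) * (a i * b j - b i * a j) ≤ 0 :=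
    sum_nonpos fun i _ => sum_nonpos fun j _ => h i j
  have hexp : ∑ i ∈ s, ∑ j ∈ s, (c j - c i) * (a i * b j - b i * a j) =
      2 * ((∑ i ∈ s, a i) * (∑ i ∈ s, c i * b i) - (∑ i ∈ s, b i) * (∑ i ∈ s, c i * a i)) := by
    have hterm : ∀ i j, (c j - c i) * (a i * b j - b i * a j) =
        a i * (c j * b j) - b i * (c j * a j) - (c i * a i) * b j + (c i * b i) * a j := by
      intro i j; ring
    simp only [hterm, sum_add_distrib, sum_sub_distrib, ← sum_mul_sum]
    ring
  linarith

theorem geom_sum_mul_geom_sum_le {x y : ℝ} (hx : 0 ≤ x) (hxy : x ≤ y) {k l : ℕ} (hkl : k ≤ l) :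
    (∑ i ∈ range k, y ^ i) * (∑ i ∈ range l, x ^ i) ≤
      (∑ i ∈ range k, x ^ i) * (∑ i ∈ range l, y ^ i) := by
  induction l, hkl using Nat.le_induction with
  | base => exact (mul_comm _ _).le
  | succ m hm ih =>
    have hstep : (∑ i ∈ range k, y ^ i) * x ^ m ≤ (∑ i ∈ range k, x ^ i) * y ^ m := by
      rw [sum_mul, sum_mul]
      refine sum_le_sum fun i hi => ?_
      obtain ⟨d, rfl⟩ := Nat.exists_eq_add_of_le ((mem_range.mp hi).le.trans hm)
      have hd : x ^ d ≤ y ^ d := pow_le_pow_left₀ hx hxy d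
      have hy : 0 ≤ y := hx.trans hxy
      calc y ^ i * x ^ (i + d) = x ^ i * y ^ i * x ^ d := by ring
        _ ≤ x ^ i * y ^ i * y ^ d := by gcongr
        _ = x ^ i * y ^ (i + d) := by ring
    rw [sum_range_succ, sum_range_succ, mul_add, mul_add]
    exact add_le_add ih hstep

theorem one_sub_pow_mul_one_sub_pow_le {x y : ℝ} (hx : 0 ≤ x) (hxy : x ≤ y) (hy : y ≤ 1)
    {k l : ℕ} (hkl : k ≤ l) :
    (1 - y ^ k) * (1 - x ^ l) ≤ (1 - x ^ k) * (1 - y ^ l) := by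
  have h := mul_le_mul_of_nonneg_left (geom_sum_mul_geom_sum_le hx hxy hkl)
    (mul_nonneg (sub_nonneg.mpr (hxy.trans hy)) (sub_nonneg.mpr hy))
  simp only [← mul_neg_geom_sum]
  linarith

/-- The factor `1 - x ^ m` and the ratio `(1 - x ^ l) / (1 - x ^ k)` vary in opposite directions
on `[0, 1]`. -/
theorem one_sub_pow_sub_mul_nonpos {x y : ℝ} (hx : 0 ≤ x) (hx1 : x ≤ 1) (hy : 0 ≤ y) (hy1 : y ≤ 1)
    {k l : ℕ} (hkl : k ≤ l) (m : ℕ) :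
    ((1 - y ^ m) - (1 - x ^ m)) * ((1 - x ^ k) * (1 - y ^ l) - (1 - x ^ l) * (1 - y ^ k)) ≤ 0 := by
  rcases le_total x y with hxy | hyx
  · have h := one_sub_pow_mul_one_sub_pow_le hx hxy hy1 hkl
    have hm := pow_le_pow_left₀ hx hxy m
    exact mul_nonpos_of_nonpos_of_nonneg (by linarith) (by linarith)
  · have h := one_sub_pow_mul_one_sub_pow_le hy hyx hx1 hkl
    have hm := pow_le_pow_left₀ hy hyx m
    exact mul_nonpos_of_nonneg_of_nonpos (by linarith) (by linarith)

/-- Monotonicity used to verify condition (A.7) of Li's theorem: for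
`λ_j ∈ (0,1]` and `β_j(k) = 1 - (1-λ_j)^k`, the ratio
`(Σ_j β_j(k))² / (Σ_j β_j(k)²)` is nondecreasing in `k` for `k ≥ 1`. -/
theorem stmt_15 {n : ℕ} (lam : Fin n → ℝ)
    (hlam : ∀ j, 0 < lam j ∧ lam j ≤ 1)
    (β : Fin n → ℕ → ℝ) (hβ : ∀ j k, β j k = 1 - (1 - lam j) ^ k) :
    ∀ k l : ℕ, 1 ≤ k → k ≤ l →
      (∑ j, β j k) ^ 2 / (∑ j, β j k ^ 2) ≤
        (∑ j, β j l) ^ 2 / (∑ j, β j l ^ 2) := by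
  intro k l hk hkl
  rcases isEmpty_or_nonempty (Fin n) with _ | _
  · simp
  have hpos : ∀ m, 1 ≤ m → ∀ j, 0 < β j m := by
    intro m hm j
    have := pow_lt_one₀ (sub_nonneg.mpr (hlam j).2) (sub_lt_self 1 (hlam j).1)
      (Nat.one_le_iff_ne_zero.mp hm)
    rw [hβ]
    linarith
  have hsq : ∀ m, 1 ≤ m → 0 < ∑ j, β j m ^ 2 := fun m hm =>
    sum_pos (fun j _ => pow_pos (hpos m hm j) 2) univ_nonempty
  have hsum : ∀ m, 1 ≤ m → 0 ≤ ∑ j, β j m := fun m hm =>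
    sum_nonneg fun j _ => (hpos m hm j).le
  have hl : 1 ≤ l := hk.trans hkl
  have hopp : ∀ m i j, (β j m - β i m) * (β i k * β j l - β i l * β j k) ≤ 0 := by
    intro m i j
    simp only [hβ]
    exact one_sub_pow_sub_mul_nonpos (by linarith [(hlam i).2]) (by linarith [(hlam i).1])
      (by linarith [(hlam j).2]) (by linarith [(hlam j).1]) hkl m
  have h₁ := sum_mul_sum_mul_le_of_opposite univ (β · k) (β · l) (β · l) (hopp l)
  have h₂ := sum_mul_sum_mul_le_of_opposite univ (β · k) (β · l) (β · k) (hopp k)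
  have hcomm : ∑ j, β j l * β j k = ∑ j, β j k * β j l :=
    sum_congr rfl fun j _ => mul_comm _ _
  simp only [hcomm, ← sq] at h₁ h₂
  rw [div_le_div_iff₀ (hsq k hk) (hsq l hl)]
  calc (∑ j, β j k) ^ 2 * ∑ j, β j l ^ 2
      = (∑ j, β j k) * ((∑ j, β j k) * ∑ j, β j l ^ 2) := by ring
    _ ≤ (∑ j, β j k) * ((∑ j, β j l) * ∑ j, β j k * β j l) :=
      mul_le_mul_of_nonneg_left h₁ (hsum k hk)
    _ = (∑ j, β j l) * ((∑ j, β j k) * ∑ j, β j k * β j l) := by ring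
    _ ≤ (∑ j, β j l) * ((∑ j, β j l) * ∑ j, β j k ^ 2) :=
      mul_le_mul_of_nonneg_left h₂ (hsum l hl)
    _ = (∑ j, β j l) ^ 2 * ∑ j, β j k ^ 2 := by ring
end
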